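/- arXiv:2308.11240 — 2 statements merged into one kernel-verified Lean document; each statement's English description precedes it below -/
import Mathlib

section
/- Let d ≥ 2 and r ∈ {1,…,d}. Then for every nonempty U' ⊆ {1,…,d−1} and every u' ∈ U', the number of permutations π of {1,…,d} such that dropPerm(π,r)(u') = min{dropPerm(π,r)(v') : v' ∈ U'}, multiplied by |U'|, equals d! (i.e., when π is uniform over all permutations of {1,…,d}, the position of the minimum of dropPerm(π,r) over U' is uniformly distributed over U', so dropPerm preserves the min-wise independence property exactly). -/
/-- `dropPerm π r` : the `(d-1)`-dimensional permutation obtained from a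
`d`-dimensional permutation `π` by deleting position `r`. -/
def dropPerm (π : ℕ → ℕ) (r : ℕ) : ℕ → ℕ := fun i =>
  if i < r then π i - (if π r < π i then 1 else 0)
  else π (i + 1) - (if π r < π (i + 1) then 1 else 0)

/-- A permutation of `Fin d` viewed as a permutation (bijection) of
`{1,…,d} ⊆ ℕ`, fixing everything outside `{1,…,d}`. -/
def permToFun (d : ℕ) (σ : Equiv.Perm (Fin d)) : ℕ → ℕ := fun i =>
  if h : 1 ≤ i ∧ i ≤ d then ((σ ⟨i - 1, by omega⟩ : Fin d) : ℕ) + 1 else i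

/-- Under a uniformly random permutation of a finite linear order, each element of a finset is
equally likely to have the smallest image. -/
theorem card_perm_forall_le_mul_card {α : Type*} [Fintype α] [LinearOrder α] (V : Finset α)
    {a : α} (ha : a ∈ V) :
    Nat.card {σ : Equiv.Perm α // ∀ v ∈ V, σ a ≤ σ v} * V.card =
      (Fintype.card α).factorial := by
  classical
  have hswap : ∀ b ∈ V, Fintype.card {σ : Equiv.Perm α // ∀ v ∈ V, σ b ≤ σ v} =
      Fintype.card {σ : Equiv.Perm α // ∀ v ∈ V, σ a ≤ σ v} := by
    intro b hb
    have hmem : ∀ v ∈ V, Equiv.swap a b v ∈ V := by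
      intro v hv
      rw [Equiv.swap_apply_def]
      split_ifs <;> assumption
    refine Fintype.card_congr ((Equiv.mulRight (Equiv.swap a b)).subtypeEquiv fun σ => ?_)
    simp only [Equiv.coe_mulRight, Equiv.Perm.mul_apply, Equiv.swap_apply_left]
    refine ⟨fun h v hv => h _ (hmem v hv), fun h v hv => ?_⟩
    simpa using h _ (hmem v hv)
  have hsum : ∑ b ∈ V, Fintype.card {σ : Equiv.Perm α // ∀ v ∈ V, σ b ≤ σ v} =
      Fintype.card (Equiv.Perm α) := by
    simp only [Fintype.card_subtype]
    rw [← Finset.card_biUnion, ← Finset.card_univ]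
    · congr 1
      ext σ
      simpa using V.exists_min_image σ ⟨a, ha⟩
    · intro b hb c hc hbc
      refine Finset.disjoint_left.2 fun σ hσb hσc => hbc (σ.injective ?_)
      rw [Finset.mem_filter] at hσb hσc
      exact le_antisymm (hσb.2 c hc) (hσc.2 b hb)
  rw [Finset.sum_congr rfl hswap, Finset.sum_const, smul_eq_mul, Fintype.card_perm] at hsum
  rw [Nat.card_eq_fintype_card, mul_comm, hsum]

theorem permToFun_add_one (d : ℕ) (σ : Equiv.Perm (Fin d)) (x : Fin d) :
    permToFun d σ ((x : ℕ) + 1) = σ x + 1 := by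
  simp [permToFun, Nat.succ_le_of_lt x.isLt]

/-- `dropPerm` compares values as the original function does, provided the right one does not
repeat the value at the deleted position. -/
theorem dropPerm_le_dropPerm_iff {π : ℕ → ℕ} {r i j : ℕ}
    (hj : π (if j < r then j else j + 1) ≠ π r) :
    dropPerm π r i ≤ dropPerm π r j ↔
      π (if i < r then i else i + 1) ≤ π (if j < r then j else j + 1) := by
  have h (k : ℕ) : dropPerm π r k = π (if k < r then k else k + 1) -
      (if π r < π (if k < r then k else k + 1) then 1 else 0) := by
    unfold dropPerm
    split_ifs <;> rfl
  rw [h, h]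
  split_ifs at * <;> omega

theorem Nat.eq_sInf_image_iff {ι : Type*} {f : ι → ℕ} {s : Set ι} {a : ι} (ha : a ∈ s) :
    f a = sInf (f '' s) ↔ ∀ b ∈ s, f a ≤ f b := by
  refine ⟨fun h b hb => h ▸ Nat.sInf_le (Set.mem_image_of_mem f hb), fun h => ?_⟩
  refine le_antisymm (le_csInf ⟨_, Set.mem_image_of_mem f ha⟩ ?_)
    (Nat.sInf_le (Set.mem_image_of_mem f ha))
  rintro _ ⟨b, hb, rfl⟩
  exact h b hb

/-- `dropPerm` preserves min-wise independence exactly: for `d ≥ 2`,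
`r ∈ {1,…,d}`, every nonempty `U' ⊆ {1,…,d-1}` and every `u' ∈ U'`, the number
of permutations `π` of `{1,…,d}` with
`dropPerm π r u' = min {dropPerm π r v' : v' ∈ U'}`, multiplied by `|U'|`,
equals `d!`. -/
theorem dropPerm_minwise (d : ℕ) (hd : 2 ≤ d) (r : ℕ) (hr : r ∈ Finset.Icc 1 d)
    (U : Finset ℕ) (hU : U ⊆ Finset.Icc 1 (d - 1)) (hne : U.Nonempty)
    (u : ℕ) (hu : u ∈ U) :
    Nat.card {σ : Equiv.Perm (Fin d) //
        dropPerm (permToFun d σ) r u =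
          sInf (dropPerm (permToFun d σ) r '' (↑U : Set ℕ))} * U.card =
      Nat.factorial d := by
  rw [Finset.mem_Icc] at hr
  have hex : ∀ i, ∃ x : Fin d, i ∈ U → (if i < r then i else i + 1) = (x : ℕ) + 1 := by
    intro i
    by_cases hi : i ∈ U
    · have := Finset.mem_Icc.1 (hU hi)
      exact ⟨⟨(if i < r then i else i + 1) - 1, by split_ifs <;> omega⟩,
        fun _ => by dsimp only; split_ifs <;> omega⟩
    · exact ⟨⟨0, by omega⟩, fun h => absurd h hi⟩
  choose e he using hex
  have hinj : Set.InjOn e U := by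
    intro i hi j hj hij
    have hi' := he i hi
    have hj' := he j hj
    rw [hij] at hi'
    split_ifs at hi' hj' <;> omega
  obtain ⟨s, rfl⟩ : ∃ s : Fin d, r = s + 1 := ⟨⟨r - 1, by omega⟩, by dsimp only; omega⟩
  have hes : ∀ i ∈ U, e i ≠ s := by
    rintro i hi rfl
    have := he i hi
    split_ifs at this <;> omega
  have hiff (σ : Equiv.Perm (Fin d)) : dropPerm (permToFun d σ) (s + 1) u =
      sInf (dropPerm (permToFun d σ) (s + 1) '' (↑U : Set ℕ)) ↔
      ∀ v ∈ U.image e, σ (e u) ≤ σ v := by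
    have hval : ∀ i ∈ U, permToFun d σ (if i < (s : ℕ) + 1 then i else i + 1) = σ (e i) + 1 :=
      fun i hi => by rw [he i hi, permToFun_add_one]
    have hoff : ∀ i ∈ U, permToFun d σ (if i < (s : ℕ) + 1 then i else i + 1) ≠
        permToFun d σ (s + 1) := by
      intro i hi h
      rw [hval i hi, permToFun_add_one] at h
      exact hes i hi (σ.injective (Fin.ext (by omega)))
    rw [Nat.eq_sInf_image_iff (Finset.mem_coe.2 hu), Finset.forall_mem_image]
    refine forall₂_congr fun v hv => ?_
    rw [dropPerm_le_dropPerm_iff (hoff v hv), hval u hu, hval v hv,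
      Nat.add_le_add_iff_right, Fin.le_def]
  simp only [hiff]
  rw [← Finset.card_image_of_injOn hinj,
    card_perm_forall_le_mul_card _ (Finset.mem_image_of_mem e hu), Fintype.card_fin]
end

section
/- Let d ≥ 2, let π be a permutation of {1,…,d}, let J ⊆ {1,…,d} be nonempty, let m ∈ {1,…,d}, and let J' be the set of nonzero indices after deleting the m-th feature. Set h_old = min{π(j) : j ∈ J} and assume h_old > π(m). Then J' is nonempty and min{dropPerm(π,m)(j') : j' ∈ J'} = h_old − 1. -/
/-- The set of nonzero indices after deleting the `m`-th feature from a binary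
vector with nonzero-index set `J`: `J' = {j ∈ J : j < m} ∪ {j-1 : j ∈ J, j > m}`. -/
def deletedSetSingle (J : Set ℕ) (m : ℕ) : Set ℕ :=
  {j | j ∈ J ∧ j < m} ∪ ((· - 1) '' {j | j ∈ J ∧ m < j})

theorem dropPerm_image_deletedSetSingle {π : ℕ → ℕ} {J : Set ℕ} {m : ℕ}
    (h : ∀ j ∈ J, π m < π j) :
    dropPerm π m '' deletedSetSingle J m = (fun j => π j - 1) '' J := by
  ext x
  constructor
  · rintro ⟨_, ⟨hj, hjm⟩ | ⟨j, ⟨hj, hjm⟩, rfl⟩, rfl⟩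
    · exact ⟨_, hj, by simp [dropPerm, hjm, h _ hj]⟩
    · have h1 : ¬ j - 1 < m := by omega
      have h2 : j - 1 + 1 = j := by omega
      exact ⟨j, hj, by simp [dropPerm, h1, h2, h j hj]⟩
  · rintro ⟨j, hj, rfl⟩
    have hne : j ≠ m := by
      rintro rfl
      exact lt_irrefl _ (h j hj)
    rcases hne.lt_or_gt with hjm | hjm
    · exact ⟨j, Or.inl ⟨hj, hjm⟩, by simp [dropPerm, hjm, h j hj]⟩
    · have h1 : ¬ j - 1 < m := by omega
      have h2 : j - 1 + 1 = j := by omega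
      exact ⟨j - 1, Or.inr ⟨j, ⟨hj, hjm⟩, rfl⟩, by simp [dropPerm, h1, h2, h j hj]⟩

/-- Let `d ≥ 2`, `π` a permutation of `{1,…,d}`, `J ⊆ {1,…,d}` nonempty,
`m ∈ {1,…,d}`, and `J'` the set of nonzero indices after deleting the `m`-th
feature.  If `h_old = min {π j : j ∈ J}` and `h_old > π m`, then `J'` is
nonempty and `min {dropPerm π m j' : j' ∈ J'} = h_old - 1`. -/
theorem dropHash_gt (d : ℕ) (hd : 2 ≤ d) (π : ℕ → ℕ)
    (hπ : Set.BijOn π (Set.Icc 1 d) (Set.Icc 1 d))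
    (J : Set ℕ) (hJ : J ⊆ Set.Icc 1 d) (hne : J.Nonempty)
    (m : ℕ) (hm : m ∈ Set.Icc 1 d)
    (hold : ℕ) (holddef : hold = sInf (π '' J)) (hgt : π m < hold) :
    (deletedSetSingle J m).Nonempty ∧
      sInf (dropPerm π m '' deletedSetSingle J m) = hold - 1 := by
  have hle : ∀ j ∈ J, hold ≤ π j := fun j hj =>
    holddef ▸ Nat.sInf_le (Set.mem_image_of_mem π hj)
  have himage := dropPerm_image_deletedSetSingle fun j hj => hgt.trans_le (hle j hj)
  refine ⟨Set.image_nonempty.mp (himage ▸ hne.image _), ?_⟩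
  rw [himage]
  obtain ⟨j, hj, hjmin⟩ : hold ∈ π '' J := holddef ▸ Nat.sInf_mem (hne.image π)
  refine IsLeast.csInf_eq ⟨⟨j, hj, by simp [hjmin]⟩, ?_⟩
  rintro _ ⟨k, hk, rfl⟩
  exact Nat.sub_le_sub_right (hle k hk) 1
end
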